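/- Let A ∈ S_n and let Δ ∈ ℝ^{n×n} be skew-symmetric (Δᵀ = −Δ). Define φ(t) = f(exp(tΔ)), where exp is the matrix exponential. Then the second derivative of φ at t = 0 (which equals the Riemannian Hessian quadratic form of f at the identity applied to Δ) is given by φ''(0) = 6 Σ_{i,j,k=1}^n (3 A_{ijj} A_{kjj} + 2 A_{jjj} A_{ikj} − A_{kii} A_{iii}) Δ_{ij} Δ_{kj}. -/

import Mathlib

open scoped BigOperators
open Matrix

/-- Orthogonal transform of a third-order tensor by a matrix `Q`:
`W i j k = ∑ p q r, A p q r * Q p i * Q q j * Q r k`. -/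
def transform (n : ℕ) (A : Fin n → Fin n → Fin n → ℝ) (Q : Matrix (Fin n) (Fin n) ℝ) :
    Fin n → Fin n → Fin n → ℝ :=
  fun i j k => ∑ p, ∑ q, ∑ r, A p q r * Q p i * Q q j * Q r k

/-- The objective `f(Q) = ∑ i, W i i i ^ 2`. -/
def fObj (n : ℕ) (A : Fin n → Fin n → Fin n → ℝ) (Q : Matrix (Fin n) (Fin n) ℝ) : ℝ :=
  ∑ i, (transform n A Q i i i) ^ 2

/-- A third-order tensor is symmetric if its entries are invariant under all permutations
of the indices (transpositions of adjacent indices suffice). -/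
def IsSymT (n : ℕ) (A : Fin n → Fin n → Fin n → ℝ) : Prop :=
  ∀ i j k : Fin n, A i j k = A j i k ∧ A i j k = A i k j

/-- The Givens rotation `G^{(i,j,θ)}`. -/
noncomputable def givens (n : ℕ) (i j : Fin n) (θ : ℝ) : Matrix (Fin n) (Fin n) ℝ :=
  Matrix.of fun k l =>
    if k = l then (if k = i ∨ k = j then Real.cos θ else 1)
    else if k = j ∧ l = i then Real.sin θ
    else if k = i ∧ l = j then -Real.sin θ
    else 0

/-- `d_{i,j}(A)`. -/
def dT (n : ℕ) (A : Fin n → Fin n → Fin n → ℝ) (i j : Fin n) : ℝ :=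
  A i i i * A i i j - A i j j * A j j j

/-- `ω_{i,j}(A)`. -/
def ωT (n : ℕ) (A : Fin n → Fin n → Fin n → ℝ) (i j : Fin n) : ℝ :=
  A i i i ^ 2 + A j j j ^ 2 - 3 * A i i j ^ 2 - 3 * A i j j ^ 2
    - 2 * A i i i * A i j j - 2 * A i i j * A j j j


section helpers
attribute [local instance] Matrix.linftyOpNormedAddCommGroup Matrix.linftyOpNormedRing
  Matrix.linftyOpNormedAlgebra Matrix.linftyOpNormedSpace

lemma exp_mul_entry_hasDerivAt (n : ℕ) (D M : Matrix (Fin n) (Fin n) ℝ) (t : ℝ) (p i : Fin n) :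
    HasDerivAt (fun t : ℝ => (NormedSpace.exp (t • D) * M) p i)
      ((NormedSpace.exp (t • D) * (D * M)) p i) t := by
  have h := hasDerivAt_exp_smul_const (𝕂 := ℝ) D t
  have h2 := h.mul_const M
  have h3 := (hasDerivAt_pi.1 ((hasDerivAt_pi.1 h2) p)) i
  rw [← Matrix.mul_assoc]
  exact h3
end helpers

lemma cubic_hasDerivAt (n : ℕ) (A : Fin n → Fin n → Fin n → ℝ) (a b c a' b' c' : ℝ → Fin n → ℝ)
    (t : ℝ) (ha : ∀ p, HasDerivAt (fun t => a t p) (a' t p) t)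
    (hb : ∀ p, HasDerivAt (fun t => b t p) (b' t p) t)
    (hc : ∀ p, HasDerivAt (fun t => c t p) (c' t p) t) :
    HasDerivAt (fun t => ∑ p, ∑ q, ∑ r, A p q r * a t p * b t q * c t r)
      ((∑ p, ∑ q, ∑ r, A p q r * a' t p * b t q * c t r)
        + (∑ p, ∑ q, ∑ r, A p q r * a t p * b' t q * c t r)
        + (∑ p, ∑ q, ∑ r, A p q r * a t p * b t q * c' t r)) t := by
  simp only [← Finset.sum_add_distrib]
  refine HasDerivAt.fun_sum fun p _ => HasDerivAt.fun_sum fun q _ => HasDerivAt.fun_sum fun r _ => ?_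
  refine ((((ha p).const_mul (A p q r)).fun_mul (hb q)).fun_mul (hc r)).congr_deriv ?_
  ring

theorem stmt_5 (n : ℕ) (A : Fin n → Fin n → Fin n → ℝ) (hA : IsSymT n A)
    (Δ : Matrix (Fin n) (Fin n) ℝ) (hΔ : Δᵀ = -Δ) :
    deriv (deriv (fun t : ℝ => fObj n A (NormedSpace.exp (t • Δ)))) 0 =
      6 * ∑ i, ∑ j, ∑ k,
        (3 * A i j j * A k j j + 2 * A j j j * A i k j - A k i i * A i i i) *
          Δ i j * Δ k j := by
  have s1 : ∀ i j k, A i j k = A j i k := fun i j k => (hA i j k).1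
  have s2 : ∀ i j k, A i j k = A i k j := fun i j k => (hA i j k).2
  have hsk : ∀ i j, Δ i j = - Δ j i := fun i j => by
    have := congrFun (congrFun hΔ j) i
    simpa using this
  obtain ⟨E, hE⟩ : ∃ E : ℝ → Matrix (Fin n) (Fin n) ℝ → Fin n → Fin n → ℝ,
      E = fun t M i p => (NormedSpace.exp (t • Δ) * M) p i := ⟨_, rfl⟩
  have hd : ∀ t M i p, HasDerivAt (fun t => E t M i p) (E t (Δ * M) i p) t := by
    intro t M i p
    rw [hE]
    exact exp_mul_entry_hasDerivAt n Δ M t p i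
  have hE0 : ∀ M i p, E 0 M i p = M p i := by
    intro M i p
    simp [hE]
  obtain ⟨T, hT⟩ : ∃ T : (Fin n → ℝ) → (Fin n → ℝ) → (Fin n → ℝ) → ℝ,
      T = fun a b c => ∑ p, ∑ q, ∑ r, A p q r * a p * b q * c r := ⟨_, rfl⟩
  have hTd : ∀ t L M N i, HasDerivAt (fun t => T (E t L i) (E t M i) (E t N i))
      (T (E t (Δ * L) i) (E t M i) (E t N i) + T (E t L i) (E t (Δ * M) i) (E t N i)
        + T (E t L i) (E t M i) (E t (Δ * N) i)) t := by
    intro t L M N i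
    rw [hT]
    exact cubic_hasDerivAt n A (fun t => E t L i) (fun t => E t M i) (fun t => E t N i)
      (fun t => E t (Δ * L) i) (fun t => E t (Δ * M) i) (fun t => E t (Δ * N) i) t
      (hd t L i) (hd t M i) (hd t N i)
  have Tsw1 : ∀ a b c, T a b c = T b a c := by
    intro a b c
    rw [hT]
    dsimp only
    rw [Finset.sum_comm]
    refine Finset.sum_congr rfl fun p _ => Finset.sum_congr rfl fun q _ =>
      Finset.sum_congr rfl fun r _ => ?_
    rw [s1]; ring
  have Tsw2 : ∀ a b c, T a b c = T a c b := by
    intro a b c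
    rw [hT]
    dsimp only
    refine Finset.sum_congr rfl fun p _ => ?_
    rw [Finset.sum_comm]
    refine Finset.sum_congr rfl fun q _ =>
      Finset.sum_congr rfl fun r _ => ?_
    rw [s2]; ring
  have hf : (fun t : ℝ => fObj n A (NormedSpace.exp (t • Δ)))
      = fun t => ∑ i, (T (E t 1 i) (E t 1 i) (E t 1 i)) ^ 2 := by
    funext t
    simp [fObj, transform, hT, hE]
  have h1 : ∀ t i, HasDerivAt (fun t => T (E t 1 i) (E t 1 i) (E t 1 i))
      (3 * T (E t Δ i) (E t 1 i) (E t 1 i)) t := by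
    intro t i
    convert hTd t 1 1 1 i using 1
    rw [Matrix.mul_one, Tsw2 (E t 1 i) (E t 1 i) (E t Δ i), Tsw1 (E t 1 i) (E t Δ i)]
    ring
  have h2 : ∀ t i, HasDerivAt (fun t => T (E t Δ i) (E t 1 i) (E t 1 i))
      (T (E t (Δ * Δ) i) (E t 1 i) (E t 1 i) + 2 * T (E t Δ i) (E t Δ i) (E t 1 i)) t := by
    intro t i
    convert hTd t Δ 1 1 i using 1
    rw [Matrix.mul_one, Tsw2 (E t Δ i) (E t 1 i) (E t Δ i)]
    ring
  have hD1 : deriv (fun t => ∑ i, (T (E t 1 i) (E t 1 i) (E t 1 i)) ^ 2) = fun t => ∑ i,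
      6 * (T (E t 1 i) (E t 1 i) (E t 1 i) * T (E t Δ i) (E t 1 i) (E t 1 i)) := by
    funext t
    refine HasDerivAt.deriv (HasDerivAt.fun_sum fun i _ => ?_)
    refine ((h1 t i).fun_pow 2).congr_deriv ?_
    norm_num
    ring
  have hD2 : HasDerivAt (fun t => ∑ i,
      6 * (T (E t 1 i) (E t 1 i) (E t 1 i) * T (E t Δ i) (E t 1 i) (E t 1 i)))
      (∑ i, 6 * ((3 * T (E 0 Δ i) (E 0 1 i) (E 0 1 i)) * T (E 0 Δ i) (E 0 1 i) (E 0 1 i)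
        + T (E 0 1 i) (E 0 1 i) (E 0 1 i) * (T (E 0 (Δ * Δ) i) (E 0 1 i) (E 0 1 i)
          + 2 * T (E 0 Δ i) (E 0 Δ i) (E 0 1 i)))) 0 :=
    HasDerivAt.fun_sum fun i _ => ((h1 0 i).mul (h2 0 i)).const_mul 6
  rw [hf, hD1, hD2.deriv]
  have e0 : ∀ j, T (E 0 1 j) (E 0 1 j) (E 0 1 j) = A j j j := by
    intro j; simp [hT, hE0, Matrix.one_apply]
  have e1 : ∀ M j, T (E 0 M j) (E 0 1 j) (E 0 1 j) = ∑ p, A p j j * M p j := by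
    intro M j; simp [hT, hE0, Matrix.one_apply]
  have e2 : ∀ j, T (E 0 Δ j) (E 0 Δ j) (E 0 1 j) = ∑ p, ∑ q, A p q j * Δ p j * Δ q j := by
    intro j; simp [hT, hE0, Matrix.one_apply]
  simp only [e0, e1, e2]
  rw [← Finset.mul_sum]
  congr 1
  have g3 : ∑ j, A j j j * ∑ p, A p j j * (Δ * Δ) p j
      = ∑ i, ∑ j, ∑ k, - (A k i i * A i i i * Δ i j * Δ k j) := by
    refine Finset.sum_congr rfl fun i _ => ?_
    simp only [Matrix.mul_apply, Finset.mul_sum]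
    rw [Finset.sum_comm]
    refine Finset.sum_congr rfl fun j _ => Finset.sum_congr rfl fun k _ => ?_
    rw [hsk j i]; ring
  have g1 : ∑ j, (3 * ∑ p, A p j j * Δ p j) * (∑ p, A p j j * Δ p j)
      = ∑ i, ∑ j, ∑ k, 3 * A i j j * A k j j * Δ i j * Δ k j := by
    rw [Finset.sum_comm]
    refine Finset.sum_congr rfl fun j _ => ?_
    rw [mul_assoc, Finset.sum_mul_sum]
    simp only [Finset.mul_sum]
    refine Finset.sum_congr rfl fun i _ => Finset.sum_congr rfl fun k _ => ?_
    ring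
  have g2 : ∑ j, A j j j * (2 * ∑ p, ∑ q, A p q j * Δ p j * Δ q j)
      = ∑ i, ∑ j, ∑ k, 2 * A j j j * A i k j * Δ i j * Δ k j := by
    rw [Finset.sum_comm (f := fun i j => ∑ k, 2 * A j j j * A i k j * Δ i j * Δ k j)]
    refine Finset.sum_congr rfl fun j _ => ?_
    simp only [Finset.mul_sum]
    refine Finset.sum_congr rfl fun i _ => Finset.sum_congr rfl fun k _ => ?_
    ring
  simp only [mul_add, Finset.sum_add_distrib]
  rw [g1, g2, g3]
  simp only [← Finset.sum_add_distrib]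
  refine Finset.sum_congr rfl fun i _ => Finset.sum_congr rfl fun j _ =>
    Finset.sum_congr rfl fun k _ => ?_
  ring
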